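/- For every x ∈ ker(1 + σ) there exist exceptional classes e, e' ∈ Λ such that x − (e − e') ∈ im(1 − σ). Equivalently, every element of the quotient ker(1+σ)/im(1−σ) (= H¹(G, Pic(Y)) for G = ⟨σ⟩) is represented by a difference e − e' of two exceptional classes. -/

import Mathlib

namespace ConicOrder

/-- The Picard lattice `Λ = ℤ⁸` of the blow-up of `ℙ²` at 7 general points,
with coordinates `(L, E₁, …, E₇)`. -/
abbrev Lam : Type := Fin 8 → ℤ

/-- The intersection form: `⟨L,L⟩ = 1`, `⟨Eᵢ,Eᵢ⟩ = −1`, distinct basis vectors orthogonal. -/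
def form (x y : Lam) : ℤ := x 0 * y 0 - ∑ i : Fin 7, x i.succ * y i.succ

/-- The class `L` of a line. -/
def Lv : Lam := fun j => if j = 0 then 1 else 0

/-- The exceptional basis classes `E₁, …, E₇` (indexed by `Fin 7`). -/
def Ev (i : Fin 7) : Lam := fun j => if j = i.succ then 1 else 0

/-- The canonical class `K = −3L + E₁ + ⋯ + E₇`. -/
def K : Lam := fun j => if j = 0 then -3 else 1

/-- The Geiser involution `σ(x) = ⟨x,K⟩·K − x`. -/
def σ (x : Lam) : Lam := form x K • K - x

/-- A class `e` is exceptional if `⟨e,e⟩ = −1` and `⟨e,K⟩ = −1`. -/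
def IsExceptional (e : Lam) : Prop := form e e = -1 ∧ form e K = -1

theorem add_σ_eq (x : Lam) : x + σ x = form x K • K := by
  simp [σ]

theorem form_add_left (x y z : Lam) : form (x + y) z = form x z + form y z := by
  simp only [form, Pi.add_apply, add_mul, Finset.sum_add_distrib]
  ring

theorem form_neg_left (x z : Lam) : form (-x) z = -form x z := by
  simp only [form, Pi.neg_apply, neg_mul, Finset.sum_neg_distrib]
  ring

theorem form_sub_left (x y z : Lam) : form (x - y) z = form x z - form y z := by
  rw [sub_eq_add_neg, form_add_left, form_neg_left, sub_eq_add_neg]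

theorem form_K_right (x : Lam) : form x K = -3 * x 0 - ∑ i : Fin 7, x i.succ := by
  simp [form, K, mul_comm]

theorem form_K_eq_zero_of_add_σ_eq_zero {x : Lam} (hx : x + σ x = 0) : form x K = 0 := by
  have h := congrFun (add_σ_eq x ▸ hx) 1
  simpa [K] using h

/-- A class orthogonal to `K` all of whose coordinates have the same parity lies in the
image of `1 − σ`. -/
theorem mem_range_sub_σ {z : Lam} (hz : form z K = 0)
    (h : ∀ i : Fin 7, 2 ∣ z i.succ - z 0) :
    z ∈ Set.range (fun y : Lam => y - σ y) := by
  have h2 : ∀ j, ∃ t, z j + z 0 * K j = 2 * t := by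
    refine Fin.cases ⟨-z 0, ?_⟩ fun i => ?_
    · simp only [K, if_true]
      ring
    · obtain ⟨t, ht⟩ := h i
      exact ⟨t + z 0, by simp only [K, Fin.succ_ne_zero, if_false]; linarith⟩
  choose y hy using h2
  have hyK : form y K = z 0 := by
    have h0 := hy 0
    have hs : ∑ i : Fin 7, (z i.succ + z 0) = ∑ i : Fin 7, 2 * y i.succ :=
      Finset.sum_congr rfl fun i _ => by simpa [K] using hy i.succ
    rw [Finset.sum_add_distrib, ← Finset.mul_sum] at hs
    rw [form_K_right] at hz ⊢
    simp only [K, if_true] at h0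
    simp at hs
    linarith
  refine ⟨y, funext fun j => ?_⟩
  simp only [σ, hyK, Pi.sub_apply, Pi.smul_apply, smul_eq_mul]
  linarith [hy j]

theorem isExceptional_Ev (i : Fin 7) : IsExceptional (Ev i) := by
  unfold IsExceptional
  revert i
  decide

/-- The class of the line through two of the blown-up points. -/
theorem isExceptional_Lv_sub {i j : Fin 7} (h : i ≠ j) :
    IsExceptional (Lv - Ev i - Ev j) := by
  unfold IsExceptional
  revert i j
  decide

/-- The class of the conic through the five blown-up points other than two given ones. -/
theorem isExceptional_conic {i j : Fin 7} (h : i ≠ j) :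
    IsExceptional (-K - Lv + Ev i + Ev j) := by
  unfold IsExceptional
  revert i j
  decide

theorem even_card_filter_not_two_dvd {ι : Type*} {s : Finset ι} {f : ι → ℤ}
    (h : 2 ∣ ∑ i ∈ s, f i) : Even (s.filter fun i => ¬ 2 ∣ f i).card := by
  have hd : (2 : ℤ) ∣ ∑ i ∈ s, (f i - if ¬ 2 ∣ f i then 1 else 0) :=
    Finset.dvd_sum fun i _ => by split_ifs <;> omega
  rw [Finset.sum_sub_distrib, Finset.sum_boole] at hd
  rw [even_iff_two_dvd]
  have := (dvd_sub_right h).1 hd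
  exact_mod_cast this

/-- A class orthogonal to `K` is congruent, modulo `2` and up to a common parity shift of all
coordinates, to a difference of two exceptional classes. -/
theorem exists_isExceptional_two_dvd {x : Lam} (hx : form x K = 0) :
    ∃ e e' : Lam, IsExceptional e ∧ IsExceptional e' ∧
      ∀ i : Fin 7, 2 ∣ (x - (e - e')) i.succ - (x - (e - e')) 0 := by
  set S : Finset (Fin 7) := Finset.univ.filter fun i => ¬ 2 ∣ x i.succ - x 0 with hS
  have hmem : ∀ i, i ∈ S ↔ ¬ 2 ∣ x i.succ - x 0 := by simp [hS]
  have heven : Even S.card := by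
    refine even_card_filter_not_two_dvd ?_
    rw [form_K_right] at hx
    rw [Finset.sum_sub_distrib]
    simp only [Finset.sum_const, Finset.card_univ, Fintype.card_fin, nsmul_eq_mul]
    omega
  have hcompl : S.card + Sᶜ.card = 7 := by simp
  have hcases : S.card = 0 ∨ S.card = 2 ∨ Sᶜ.card = 3 ∨ Sᶜ.card = 1 := by
    obtain ⟨k, hk⟩ := heven
    omega
  have hmem' : ∀ i, i ∈ Sᶜ ↔ 2 ∣ x i.succ - x 0 := fun i => by
    rw [Finset.mem_compl, hmem, not_not]
  clear_value S
  rcases hcases with h | h | h | h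
  · rw [Finset.card_eq_zero] at h
    refine ⟨Ev 0, Ev 0, isExceptional_Ev 0, isExceptional_Ev 0, fun i => ?_⟩
    simpa [h] using hmem i
  · obtain ⟨a, b, hab, rfl⟩ := Finset.card_eq_two.1 h
    refine ⟨Ev a, Ev b, isExceptional_Ev a, isExceptional_Ev b, fun i => ?_⟩
    have hi := hmem i
    simp only [Finset.mem_insert, Finset.mem_singleton] at hi
    simp [Ev, (Fin.succ_ne_zero _).symm]
    grind
  · obtain ⟨a, b, c, hab, hac, hbc, habc⟩ := Finset.card_eq_three.1 h
    refine ⟨Lv - Ev a - Ev b, Ev c, isExceptional_Lv_sub hab, isExceptional_Ev c, fun i => ?_⟩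
    have hi := hmem' i
    simp only [habc, Finset.mem_insert, Finset.mem_singleton] at hi
    simp [Ev, Lv, (Fin.succ_ne_zero _).symm]
    grind
  · obtain ⟨a, ha⟩ := Finset.card_eq_one.1 h
    obtain ⟨b, hab⟩ := exists_ne a
    refine ⟨-K - Lv + Ev a + Ev b, Ev b, isExceptional_conic hab.symm, isExceptional_Ev b,
      fun i => ?_⟩
    have hi := hmem' i
    simp only [ha, Finset.mem_singleton] at hi
    simp [Ev, Lv, K, (Fin.succ_ne_zero _).symm]
    grind

/-- every element of `ker(1 + σ)` is, modulo `im(1 − σ)`, a difference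
of two exceptional classes. -/
theorem ker_class_repr_by_diff_of_exceptionals (x : Lam) (hx : x + σ x = 0) :
    ∃ e e' : Lam, IsExceptional e ∧ IsExceptional e' ∧
      x - (e - e') ∈ Set.range (fun y : Lam => y - σ y) := by
  have hxK := form_K_eq_zero_of_add_σ_eq_zero hx
  obtain ⟨e, e', he, he', h⟩ := exists_isExceptional_two_dvd hxK
  refine ⟨e, e', he, he', mem_range_sub_σ ?_ h⟩
  rw [form_sub_left, form_sub_left, hxK, he.2, he'.2]
  norm_num

end ConicOrder
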